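/- Let n ≥ 1, let α_1,…,α_n be programs, let φ_1,…,φ_n be formulas, let ψ_1,…,ψ_n be variable-free formulas, and let x be a variable. Then the equivalence ⟨α_1⟩(φ_1 ∧ (ψ_1 ∨ ⟨α_2⟩(φ_2 ∧ (ψ_2 ∨ … ⟨α_n⟩(φ_n ∧ (ψ_n ∨ x)) … )))) ≡ ⟨α_1;φ_1?⟩[¬̄ψ_1?]⟨α_2;φ_2?⟩[¬̄ψ_2?] ⋯ ⟨α_n;φ_n?⟩[¬̄ψ_n?] x is valid, i.e., both sides are satisfied at exactly the same worlds of every model. -/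

import Mathlib

mutual
inductive PDLFormula (P V A : Type) : Type
  | var : V → PDLFormula P V A
  | atom : P → PDLFormula P V A
  | natom : P → PDLFormula P V A
  | or : PDLFormula P V A → PDLFormula P V A → PDLFormula P V A
  | and : PDLFormula P V A → PDLFormula P V A → PDLFormula P V A
  | dia : PDLProgram P V A → PDLFormula P V A → PDLFormula P V A
  | box : PDLProgram P V A → PDLFormula P V A → PDLFormula P V A

inductive PDLProgram (P V A : Type) : Type
  | aprog : A → PDLProgram P V A
  | test : PDLFormula P V A → PDLProgram P V A
  | seq : PDLProgram P V A → PDLProgram P V A → PDLProgram P V A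
  | union : PDLProgram P V A → PDLProgram P V A → PDLProgram P V A
  | star : PDLProgram P V A → PDLProgram P V A
end

structure PDLModel (P V A : Type) where
  W : Type
  nonempty : Nonempty W
  R : A → W → W → Prop
  Vp : P → Set W
  Vv : V → Set W

mutual
def PDLModel.Sat {P V A : Type} (M : PDLModel P V A) : PDLFormula P V A → M.W → Prop
  | .var x => fun w => w ∈ M.Vv x
  | .atom p => fun w => w ∈ M.Vp p
  | .natom p => fun w => w ∉ M.Vp p
  | .or φ ψ => fun w => M.Sat φ w ∨ M.Sat ψ w
  | .and φ ψ => fun w => M.Sat φ w ∧ M.Sat ψ w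
  | .dia α φ => fun w => ∃ u, M.Rel α w u ∧ M.Sat φ u
  | .box α φ => fun w => ∀ u, M.Rel α w u → M.Sat φ u

def PDLModel.Rel {P V A : Type} (M : PDLModel P V A) : PDLProgram P V A → M.W → M.W → Prop
  | .aprog a => M.R a
  | .test φ => fun w u => w = u ∧ M.Sat φ w
  | .seq α β => fun w u => ∃ v, M.Rel α w v ∧ M.Rel β v u
  | .union α β => fun w u => M.Rel α w u ∨ M.Rel β w u
  | .star α => Relation.ReflTransGen (M.Rel α)
end

def PDLFormula.nneg {P V A : Type} : PDLFormula P V A → PDLFormula P V A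
  | .var x => .var x
  | .atom p => .natom p
  | .natom p => .atom p
  | .or φ ψ => .and φ.nneg ψ.nneg
  | .and φ ψ => .or φ.nneg ψ.nneg
  | .dia α φ => .box α φ.nneg
  | .box α φ => .dia α φ.nneg

mutual
def PDLFormula.noVar {P V A : Type} : PDLFormula P V A → Prop
  | .var _ => False
  | .atom _ => True
  | .natom _ => True
  | .or φ ψ => φ.noVar ∧ ψ.noVar
  | .and φ ψ => φ.noVar ∧ ψ.noVar
  | .dia α φ => α.noVar ∧ φ.noVar
  | .box α φ => α.noVar ∧ φ.noVar

def PDLProgram.noVar {P V A : Type} : PDLProgram P V A → Prop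
  | .aprog _ => True
  | .test φ => φ.noVar
  | .seq α β => α.noVar ∧ β.noVar
  | .union α β => α.noVar ∧ β.noVar
  | .star α => α.noVar
end

mutual
def PDLFormula.xFree {P V A : Type} (x : V) : PDLFormula P V A → Prop
  | .var y => y ≠ x
  | .atom _ => True
  | .natom _ => True
  | .or φ ψ => φ.xFree x ∧ ψ.xFree x
  | .and φ ψ => φ.xFree x ∧ ψ.xFree x
  | .dia α φ => α.xFree x ∧ φ.xFree x
  | .box α φ => α.xFree x ∧ φ.xFree x

def PDLProgram.xFree {P V A : Type} (x : V) : PDLProgram P V A → Prop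
  | .aprog _ => True
  | .test φ => φ.xFree x
  | .seq α β => α.xFree x ∧ β.xFree x
  | .union α β => α.xFree x ∧ β.xFree x
  | .star α => α.xFree x
end

mutual
def PDLFormula.subst {P V A : Type} [DecidableEq V] (x : V) (ψ : PDLFormula P V A) :
    PDLFormula P V A → PDLFormula P V A
  | .var y => if y = x then ψ else .var y
  | .atom p => .atom p
  | .natom p => .natom p
  | .or φ χ => .or (PDLFormula.subst x ψ φ) (PDLFormula.subst x ψ χ)
  | .and φ χ => .and (PDLFormula.subst x ψ φ) (PDLFormula.subst x ψ χ)
  | .dia α φ => .dia (PDLProgram.subst x ψ α) (PDLFormula.subst x ψ φ)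
  | .box α φ => .box (PDLProgram.subst x ψ α) (PDLFormula.subst x ψ φ)

def PDLProgram.subst {P V A : Type} [DecidableEq V] (x : V) (ψ : PDLFormula P V A) :
    PDLProgram P V A → PDLProgram P V A
  | .aprog a => .aprog a
  | .test φ => .test (PDLFormula.subst x ψ φ)
  | .seq α β => .seq (PDLProgram.subst x ψ α) (PDLProgram.subst x ψ β)
  | .union α β => .union (PDLProgram.subst x ψ α) (PDLProgram.subst x ψ β)
  | .star α => .star (PDLProgram.subst x ψ α)
end

/-- Nested box form: `[α_i](φ_i ∨ (ψ_i ∧ [α_{i+1}](…)))` with `m` levels starting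
at index `i`, and the variable `x` innermost. -/
def nestBoxOr {P V A : Type} (αs : ℕ → PDLProgram P V A) (φs ψs : ℕ → PDLFormula P V A)
    (x : V) : ℕ → ℕ → PDLFormula P V A
  | 0, _ => .var x
  | m + 1, i => .box (αs i) (.or (φs i) (.and (ψs i) (nestBoxOr αs φs ψs x m (i + 1))))

/-- Nested diamond form: `⟨α_i⟩(φ_i ∧ (ψ_i ∨ ⟨α_{i+1}⟩(…)))` with `m` levels starting
at index `i`, and the variable `x` innermost. -/
def nestDiaAnd {P V A : Type} (αs : ℕ → PDLProgram P V A) (φs ψs : ℕ → PDLFormula P V A)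
    (x : V) : ℕ → ℕ → PDLFormula P V A
  | 0, _ => .var x
  | m + 1, i => .dia (αs i) (.and (φs i) (.or (ψs i) (nestDiaAnd αs φs ψs x m (i + 1))))

/-- `seqPrefFrom base step j = base ; step 2 ; step 3 ; … ; step j` (left associated);
for `j ≤ 1` it is just `base`. -/
def seqPrefFrom {P V A : Type} (base : PDLProgram P V A) (step : ℕ → PDLProgram P V A) :
    ℕ → PDLProgram P V A
  | 0 => base
  | 1 => base
  | j + 2 => .seq (seqPrefFrom base step (j + 1)) (step (j + 2))

/-- `bigAndUp χ n = χ 1 ∧ χ 2 ∧ … ∧ χ n` (left associated); `bigAndUp χ 1 = χ 1`. -/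
def bigAndUp {P V A : Type} (χ : ℕ → PDLFormula P V A) : ℕ → PDLFormula P V A
  | 0 => χ 0
  | 1 => χ 1
  | j + 2 => .and (bigAndUp χ (j + 1)) (χ (j + 2))

/-- `bigOrUp χ n = χ 1 ∨ χ 2 ∨ … ∨ χ n` (left associated); `bigOrUp χ 1 = χ 1`. -/
def bigOrUp {P V A : Type} (χ : ℕ → PDLFormula P V A) : ℕ → PDLFormula P V A
  | 0 => χ 0
  | 1 => χ 1
  | j + 2 => .or (bigOrUp χ (j + 1)) (χ (j + 2))

/-- The right-hand side form `⟨α_i;φ_i?⟩[¬̄ψ_i?] … x` with `m` levels from index `i`. -/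
def diaBoxChain {P V A : Type} (αs : ℕ → PDLProgram P V A) (φs ψs : ℕ → PDLFormula P V A)
    (x : V) : ℕ → ℕ → PDLFormula P V A
  | 0, _ => .var x
  | m + 1, i =>
      .dia (.seq (αs i) (.test (φs i)))
        (.box (.test (ψs i).nneg) (diaBoxChain αs φs ψs x m (i + 1)))

theorem PDLFormula.sat_nneg {P V A : Type} (M : PDLModel P V A) :
    ∀ (φ : PDLFormula P V A), φ.noVar → ∀ w : M.W, M.Sat φ.nneg w ↔ ¬ M.Sat φ w
  | .var _, h => by simp [PDLFormula.noVar] at h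
  | .atom _, _ => by simp [PDLFormula.nneg, PDLModel.Sat]
  | .natom _, _ => by simp [PDLFormula.nneg, PDLModel.Sat]
  | .or φ ψ, h => by
      simp only [PDLFormula.noVar] at h
      simp [PDLFormula.nneg, PDLModel.Sat, sat_nneg M φ h.1, sat_nneg M ψ h.2]
  | .and φ ψ, h => by
      simp only [PDLFormula.noVar] at h
      simp [PDLFormula.nneg, PDLModel.Sat, sat_nneg M φ h.1, sat_nneg M ψ h.2,
        imp_iff_not_or]
  | .dia α φ, h => by
      simp only [PDLFormula.noVar] at h
      simp [PDLFormula.nneg, PDLModel.Sat, sat_nneg M φ h.2]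
  | .box α φ, h => by
      simp only [PDLFormula.noVar] at h
      simp [PDLFormula.nneg, PDLModel.Sat, sat_nneg M φ h.2]

theorem sat_nestDiaAnd_iff_diaBoxChain {P V A : Type} (M : PDLModel P V A) (x : V)
    (αs : ℕ → PDLProgram P V A) (φs ψs : ℕ → PDLFormula P V A) (m i : ℕ)
    (hψ : ∀ j, i ≤ j → j < i + m → (ψs j).noVar) (w : M.W) :
    M.Sat (nestDiaAnd αs φs ψs x m i) w ↔ M.Sat (diaBoxChain αs φs ψs x m i) w := by
  induction m generalizing i w with
  | zero => simp [nestDiaAnd, diaBoxChain]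
  | succ m ih =>
    have hn := PDLFormula.sat_nneg M (ψs i) (hψ i le_rfl (by omega))
    have ih' := ih (i + 1) fun j h₁ h₂ => hψ j (by omega) (by omega)
    simp only [nestDiaAnd, diaBoxChain, PDLModel.Sat, PDLModel.Rel, ih', hn]
    constructor
    · rintro ⟨u, hu, hφ, h⟩
      refine ⟨u, ⟨u, hu, rfl, hφ⟩, ?_⟩
      rintro _ ⟨rfl, hψu⟩
      exact h.resolve_left hψu
    · rintro ⟨u, ⟨_, hu, rfl, hφ⟩, h⟩
      exact ⟨_, hu, hφ, or_iff_not_imp_left.2 fun hψu => h _ ⟨rfl, hψu⟩⟩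

/-- for `n ≥ 1`, programs `α_1,…,α_n`, arbitrary formulas `φ_1,…,φ_n`
and variable-free formulas `ψ_1,…,ψ_n`,
`⟨α_1⟩(φ_1 ∧ (ψ_1 ∨ ⟨α_2⟩(φ_2 ∧ (ψ_2 ∨ … ⟨α_n⟩(φ_n ∧ (ψ_n ∨ x))…))))
 ≡ ⟨α_1;φ_1?⟩[¬̄ψ_1?]⟨α_2;φ_2?⟩[¬̄ψ_2?] ⋯ ⟨α_n;φ_n?⟩[¬̄ψ_n?]x` is valid. -/
theorem dia_form_equiv_chain {P V A : Type}
    (x : V) (n : ℕ) (hn : 1 ≤ n)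
    (αs : ℕ → PDLProgram P V A) (φs ψs : ℕ → PDLFormula P V A)
    (hψ : ∀ i, 1 ≤ i → i ≤ n → (ψs i).noVar) :
    ∀ (M : PDLModel P V A) (w : M.W),
      M.Sat (nestDiaAnd αs φs ψs x n 1) w ↔ M.Sat (diaBoxChain αs φs ψs x n 1) w := by
  exact fun M w => sat_nestDiaAnd_iff_diaBoxChain M x αs φs ψs n 1
    (fun i h₁ h₂ => hψ i h₁ (by omega)) w
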